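/- Assume: β̂, β̂_Γ : ℝ → [0,+∞] are convex, proper, lower semicontinuous with β̂(0) = β̂_Γ(0) = 0; β := ∂β̂ and β_Γ := ∂β̂_Γ are their subdifferentials; D(β) ⊇ D(β_Γ); η > 0 and C_Γ ≥ 0 are constants such that |β°(r)| ≤ η|β_Γ°(r)| + C_Γ for every r ∈ D(β_Γ). Then for every ε > 0 and every s > εC_Γ the resolvents compare as (I + εβ)⁻¹(s) ≥ (I + ε(ηβ_Γ + C_Γ))⁻¹(s); that is, if y₁, y₂ ∈ ℝ satisfy (y₁, (s − y₁)/ε) ∈ β and (y₂, (s − y₂)/ε) ∈ ηβ_Γ + C_Γ := {(r, ηt + C_Γ) : (r,t) ∈ β_Γ}, then y₁ ≥ y₂. -/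

import Mathlib

/-- Convexity for an `EReal`-valued function on ℝ. -/
def ERealConvexOn (φ : ℝ → EReal) : Prop :=
  ∀ x y : ℝ, ∀ t : ℝ, 0 ≤ t → t ≤ 1 →
    φ (t * x + (1 - t) * y) ≤ (t : EReal) * φ x + ((1 - t : ℝ) : EReal) * φ y

/-- The subdifferential graph `∂φ ⊆ ℝ × ℝ` of `φ : ℝ → [0,+∞]`. -/
def subdiff (φ : ℝ → EReal) : Set (ℝ × ℝ) :=
  {p | φ p.1 ≠ ⊤ ∧ ∀ w : ℝ, φ p.1 + ((p.2 * (w - p.1) : ℝ) : EReal) ≤ φ w}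

/-- The minimal section `γ°(r)`: the element of `γ(r)` of minimum absolute value. -/
noncomputable def minSection (γ : Set (ℝ × ℝ)) (r : ℝ) : ℝ :=
  Classical.epsilon fun s => (r, s) ∈ γ ∧ ∀ t : ℝ, (r, t) ∈ γ → |s| ≤ |t|

theorem mem_subdiff_iff_toReal {φ : ℝ → EReal} (hφ : ∀ r, 0 ≤ φ r) {r t : ℝ} :
    (r, t) ∈ subdiff φ ↔
      φ r ≠ ⊤ ∧ ∀ w, φ w ≠ ⊤ → (φ r).toReal + t * (w - r) ≤ (φ w).toReal := by
  have hbot : ∀ w, φ w ≠ ⊥ := fun w => (EReal.bot_lt_zero.trans_le (hφ w)).ne'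
  refine and_congr_right fun hr => forall_congr' fun w => ?_
  by_cases hw : φ w = ⊤
  · simp [hw]
  · simp only [ne_eq, hw, not_false_eq_true, forall_const]
    rw [← EReal.coe_le_coe_iff, EReal.coe_add, EReal.coe_toReal hr (hbot r),
      EReal.coe_toReal hw (hbot w)]

theorem subdiff_monotone {φ : ℝ → EReal} (hφ : ∀ r, 0 ≤ φ r) {r₁ r₂ t₁ t₂ : ℝ}
    (h₁ : (r₁, t₁) ∈ subdiff φ) (h₂ : (r₂, t₂) ∈ subdiff φ) :
    0 ≤ (t₁ - t₂) * (r₁ - r₂) := by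
  rw [mem_subdiff_iff_toReal hφ] at h₁ h₂
  linarith [h₁.2 r₂ h₂.1, h₂.2 r₁ h₁.1]

theorem zero_mem_subdiff {φ : ℝ → EReal} (hφ : ∀ r, 0 ≤ φ r) (h0 : φ 0 = 0) :
    ((0 : ℝ), (0 : ℝ)) ∈ subdiff φ :=
  ⟨by simp [h0], fun w => by simpa [h0] using hφ w⟩

theorem isClosed_subdiff_section {φ : ℝ → EReal} (hφ : ∀ r, 0 ≤ φ r) (r : ℝ) :
    IsClosed {t : ℝ | (r, t) ∈ subdiff φ} := by
  simp only [mem_subdiff_iff_toReal hφ, Set.ofPred_and, Set.ofPred_forall]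
  refine IsClosed.inter (isClosed_iInter fun _ => isClosed_const) ?_
  refine isClosed_iInter fun w => isClosed_iInter fun _ => ?_
  exact isClosed_le (f := fun t : ℝ => (φ r).toReal + t * (w - r)) (by fun_prop) continuous_const

theorem minSection_spec {φ : ℝ → EReal} (hφ : ∀ r, 0 ≤ φ r) {r : ℝ}
    (h : ∃ t, (r, t) ∈ subdiff φ) :
    (r, minSection (subdiff φ) r) ∈ subdiff φ ∧
      ∀ t, (r, t) ∈ subdiff φ → |minSection (subdiff φ) r| ≤ |t| := by
  refine Classical.epsilon_spec
    (p := fun s => (r, s) ∈ subdiff φ ∧ ∀ t : ℝ, (r, t) ∈ subdiff φ → |s| ≤ |t|) ?_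
  obtain ⟨m, hm, hdist⟩ := (isClosed_subdiff_section hφ r).exists_infDist_eq_dist h 0
  refine ⟨m, hm, fun t ht => ?_⟩
  have hle := Metric.infDist_le_dist_of_mem (s := {t : ℝ | (r, t) ∈ subdiff φ}) (x := 0) ht
  simpa [hdist] using hle

/-- Resolvent comparison (the key step in Lemma 4.3 of the paper).
Assume `β̂, β̂_Γ : ℝ → [0,+∞]` convex, proper, l.s.c. with `β̂(0) = β̂_Γ(0) = 0`,
`β = ∂β̂`, `β_Γ = ∂β̂_Γ`, `D(β) ⊇ D(β_Γ)`, and `|β°(r)| ≤ η|β_Γ°(r)| + C_Γ` on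
`D(β_Γ)` with `η > 0`, `C_Γ ≥ 0`. Then for `ε > 0` and `s > εC_Γ`, the resolvents
compare: if `(y₁, (s − y₁)/ε) ∈ β` and `(y₂, (s − y₂)/ε) ∈ ηβ_Γ + C_Γ`,
then `y₁ ≥ y₂`. -/
theorem resolvent_compare (betaHat betaGammaHat : ℝ → EReal)
    (hnn : ∀ r : ℝ, 0 ≤ betaHat r) (hnnΓ : ∀ r : ℝ, 0 ≤ betaGammaHat r)
    (hconv : ERealConvexOn betaHat) (hconvΓ : ERealConvexOn betaGammaHat)
    (hlsc : LowerSemicontinuous betaHat) (hlscΓ : LowerSemicontinuous betaGammaHat)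
    (hzero : betaHat 0 = 0) (hzeroΓ : betaGammaHat 0 = 0)
    (η CΓ : ℝ) (hη : 0 < η) (hCΓ : 0 ≤ CΓ)
    (hdom : ∀ r : ℝ, (∃ t : ℝ, (r, t) ∈ subdiff betaGammaHat) →
      ∃ t : ℝ, (r, t) ∈ subdiff betaHat)
    (hcomp : ∀ r : ℝ, (∃ t : ℝ, (r, t) ∈ subdiff betaGammaHat) →
      |minSection (subdiff betaHat) r| ≤ η * |minSection (subdiff betaGammaHat) r| + CΓ) :
    ∀ ε : ℝ, 0 < ε → ∀ s : ℝ, ε * CΓ < s → ∀ y₁ y₂ : ℝ,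
      (y₁, (s - y₁) / ε) ∈ subdiff betaHat →
      (y₂, (s - y₂) / ε) ∈ (fun p : ℝ × ℝ => (p.1, η * p.2 + CΓ)) '' subdiff betaGammaHat →
      y₂ ≤ y₁ := by
  rintro ε hε s hs y₁ y₂ h₁ ⟨⟨r, t⟩, h₂, heq⟩
  obtain ⟨rfl, ht⟩ := Prod.mk.inj heq
  dsimp only at h₁ h₂ ht ⊢
  by_contra! hlt
  have hεC : 0 ≤ ε * CΓ := by positivity
  have hy₁ : 0 ≤ y₁ := by
    by_contra! hneg
    have hmono := subdiff_monotone hnn h₁ (zero_mem_subdiff hnn hzero)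
    have hpos : 0 < (s - y₁) / ε := div_pos (by linarith) hε
    nlinarith
  have hr : 0 < r := hy₁.trans_lt hlt
  have ht0 : 0 ≤ t := by
    have hmono := subdiff_monotone hnnΓ h₂ (zero_mem_subdiff hnnΓ hzeroΓ)
    simp only [sub_zero] at hmono
    exact nonneg_of_mul_nonneg_left hmono hr
  have hmin := (minSection_spec hnnΓ ⟨t, h₂⟩).2 t h₂
  rw [abs_of_nonneg ht0] at hmin
  have hle : minSection (subdiff betaHat) r ≤ η * t + CΓ :=
    (le_abs_self _).trans ((hcomp r ⟨t, h₂⟩).trans (by gcongr))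
  have hmono := subdiff_monotone hnn (minSection_spec hnn (hdom r ⟨t, h₂⟩)).1 h₁
  have hstep : (s - y₁) / ε ≤ minSection (subdiff betaHat) r :=
    sub_nonneg.mp (nonneg_of_mul_nonneg_left hmono (sub_pos.mpr hlt))
  have hdiv : (s - r) / ε < (s - y₁) / ε := by gcongr
  linarith
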